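/- arXiv:2309.03005 — 2 statements merged into one kernel-verified Lean document; each statement's English description precedes it below -/
import Mathlib

section
/- Let a ∈ EuclideanSpace ℝ (Fin n) with a ≠ 0, let x, x⋆ ∈ EuclideanSpace ℝ (Fin n), let δ ∈ ℝ, and define the row-Kaczmarz step x' = x + ((⟪a, x⋆⟫ + δ − ⟪a, x⟫)/‖a‖²) • a. Then ‖x' − x⋆‖² = ‖x − x⋆‖² − ⟪a, x − x⋆⟫²/‖a‖² + δ²/‖a‖². -/
open RealInnerProductSpace

/-- Pythagorean identity for one extended-Kaczmarz `x`-update.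
For `a ≠ 0`, `δ ∈ ℝ` and `x' = x + ((⟪a, x⋆⟫ + δ − ⟪a, x⟫)/‖a‖²) • a`, one has
`‖x' − x⋆‖² = ‖x − x⋆‖² − ⟪a, x − x⋆⟫²/‖a‖² + δ²/‖a‖²`. -/
theorem row_kaczmarz_step_error {n : ℕ} (a x xstar : EuclideanSpace ℝ (Fin n))
    (ha : a ≠ 0) (δ : ℝ) :
    ‖(x + ((⟪a, xstar⟫ + δ - ⟪a, x⟫) / ‖a‖ ^ 2) • a) - xstar‖ ^ 2
      = ‖x - xstar‖ ^ 2 - ⟪a, x - xstar⟫ ^ 2 / ‖a‖ ^ 2 + δ ^ 2 / ‖a‖ ^ 2 := by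
  have hne : ‖a‖ ≠ 0 := norm_ne_zero_iff.mpr ha
  rw [add_sub_right_comm, norm_add_sq_real, inner_smul_right, norm_smul, mul_pow,
    Real.norm_eq_abs, sq_abs, real_inner_comm a (x - xstar), inner_sub_right]
  field_simp
  ring
end

section
/- Let ν, α, μ, D be real numbers with 0 ≤ ν < 1, 0 ≤ α ≤ 1, μ ≥ 0, D ≥ 0, and let ω ≥ 1 be a natural number. Let e, δ : ℕ → ℝ be sequences of nonnegative reals such that for all k, e(k+1) ≤ ν·e(k) + μ·δ(k+1), and for all k, δ(k) ≤ α^(ωk)·D. Then for every k, e(k) ≤ ν^k · e(0) + (ν^(k − ⌊k/2⌋) + α^(ω·⌊k/2⌋)) · μ·D/(1 − ν). -/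
/-- A sequence with `u (n + 1) ≤ ν * u n + c` satisfies `u n ≤ ν ^ n * u 0 + c / (1 - ν)`. -/
theorem le_pow_mul_add_div_of_le_mul_add {ν c : ℝ} (hν₀ : 0 ≤ ν) (hν₁ : ν < 1) (hc : 0 ≤ c)
    {u : ℕ → ℝ} (hu : ∀ n, u (n + 1) ≤ ν * u n + c) (n : ℕ) :
    u n ≤ ν ^ n * u 0 + c / (1 - ν) := by
  have h : 0 < 1 - ν := sub_pos.mpr hν₁
  induction n with
  | zero => simpa using div_nonneg hc h.le
  | succ n ih =>
    calc u (n + 1) ≤ ν * u n + c := hu n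
      _ ≤ ν * (ν ^ n * u 0 + c / (1 - ν)) + c := by gcongr
      _ = ν ^ (n + 1) * u 0 + c / (1 - ν) := by
        field_simp
        ring

/-- telescoping recurrence estimate used in Theorem 2.2 of the
paper.  If `0 ≤ ν < 1`, `0 ≤ α ≤ 1`, `μ, D ≥ 0`, `ω ≥ 1`, and the nonnegative
sequences `e, δ` satisfy `e(k+1) ≤ ν e(k) + μ δ(k+1)` and `δ(k) ≤ α^(ωk) D`,
then `e(k) ≤ ν^k e(0) + (ν^(k−⌊k/2⌋) + α^(ω⌊k/2⌋)) μD/(1−ν)` for all `k`. -/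
theorem telescoping_recurrence_bound (ν α μ D : ℝ)
    (hν₀ : 0 ≤ ν) (hν₁ : ν < 1) (hα₀ : 0 ≤ α) (hα₁ : α ≤ 1)
    (hμ : 0 ≤ μ) (hD : 0 ≤ D) (ω : ℕ) (hω : 1 ≤ ω)
    (e δ : ℕ → ℝ) (he : ∀ k, 0 ≤ e k) (hδ : ∀ k, 0 ≤ δ k)
    (hrec : ∀ k, e (k + 1) ≤ ν * e k + μ * δ (k + 1))
    (hδD : ∀ k, δ k ≤ α ^ (ω * k) * D) :
    ∀ k, e k ≤ ν ^ k * e 0 +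
      (ν ^ (k - k / 2) + α ^ (ω * (k / 2))) * (μ * D / (1 - ν)) := by
  have hμD : 0 ≤ μ * D := mul_nonneg hμ hD
  -- After `m` steps, the inhomogeneous term is at most `α ^ (ω * m) * (μ * D)`.
  have htail (m j : ℕ) :
      e (m + j) ≤ ν ^ j * e m + α ^ (ω * m) * (μ * D) / (1 - ν) := by
    refine le_pow_mul_add_div_of_le_mul_add (u := fun i => e (m + i)) hν₀ hν₁
      (by positivity) (fun i => ?_) j
    calc e (m + i + 1) ≤ ν * e (m + i) + μ * δ (m + i + 1) := hrec _
      _ ≤ ν * e (m + i) + μ * (α ^ (ω * m) * D) := by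
        gcongr
        refine (hδD _).trans (mul_le_mul_of_nonneg_right ?_ hD)
        exact pow_le_pow_of_le_one hα₀ hα₁ (Nat.mul_le_mul_left ω (by lia))
      _ = ν * e (m + i) + α ^ (ω * m) * (μ * D) := by ring
  intro k
  have hk : k / 2 + (k - k / 2) = k := by lia
  have hhead : e (k / 2) ≤ ν ^ (k / 2) * e 0 + μ * D / (1 - ν) := by
    simpa using htail 0 (k / 2)
  calc e k = e (k / 2 + (k - k / 2)) := by rw [hk]
    _ ≤ ν ^ (k - k / 2) * e (k / 2) + α ^ (ω * (k / 2)) * (μ * D) / (1 - ν) := htail _ _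
    _ ≤ ν ^ (k - k / 2) * (ν ^ (k / 2) * e 0 + μ * D / (1 - ν)) +
        α ^ (ω * (k / 2)) * (μ * D) / (1 - ν) := by gcongr
    _ = ν ^ (k / 2 + (k - k / 2)) * e 0 +
        (ν ^ (k - k / 2) + α ^ (ω * (k / 2))) * (μ * D / (1 - ν)) := by
      rw [pow_add]
      ring
    _ = _ := by rw [hk]
end
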